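/- For every J ⊆ 𝒥, writing J^δ = J Δ (J−1)^{ss}, one has Σ_{j : j+1 ∈ J^δ}(p−1−s^{(J−1)^{ss}}_j)p^j − Σ_{j=0}^{f−1} s^J_j p^j ≡ Σ_{j : j+1 ∉ J^δ}(p−1−s^{(J−1)^{ss}}_j)p^j (mod q−1). -/

import Mathlib

open Finset
open scoped symmDiff

def shiftSet (f : ℕ) (J : Finset (ZMod f)) (k : ℤ) : Finset (ZMod f) :=
  J.image (fun j => j + (k : ZMod f))

def deltaSS (f : ℕ) (Jrho J : Finset (ZMod f)) : Finset (ZMod f) :=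
  shiftSet f J (-1) ∩ Jrho

def sfun (p f : ℕ) (r : ZMod f → ℤ) (Jrho J : Finset (ZMod f)) (j : ZMod f) : ℤ :=
  if j ∈ J then
    if j + 1 ∈ J then (if j ∈ Jrho then (p : ℤ) - 3 - r j else (p : ℤ) - 1 - r j)
    else r j + 1
  else
    if j + 1 ∈ J then (p : ℤ) - 2 - r j else r j

def tfun (f : ℕ) (r : ZMod f → ℤ) (Jrho J : Finset (ZMod f)) (j : ZMod f) : ℤ :=
  if j ∈ J then
    if j + 1 ∈ J then (if j ∈ Jrho then r j + 1 else r j)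
    else -1
  else
    if j + 1 ∈ J then r j + 1 else 0


theorem pow_mod_modEq_pow (a : ℤ) (f n : ℕ) : a ^ (n % f) ≡ a ^ n [ZMOD a ^ f - 1] := by
  have key : a ^ f ≡ 1 [ZMOD a ^ f - 1] := Int.modEq_sub (a ^ f) 1
  conv_rhs => rw [← Nat.mod_add_div n f, pow_add, pow_mul]
  simpa using ((key.pow (n / f)).mul_left (a ^ (n % f))).symm

/-- Multiplying a base-`a` expansion by `a` rotates its digits modulo `a ^ f - 1`. -/
theorem sum_shift_modEq (a : ℤ) (f : ℕ) [NeZero f] (c : ZMod f → ℤ) :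
    ∑ j : ZMod f, c (j + 1) * a * a ^ j.val ≡ ∑ j : ZMod f, c j * a ^ j.val
      [ZMOD a ^ f - 1] := by
  rw [← Equiv.sum_comp (Equiv.addRight (1 : ZMod f)) (fun j => c j * a ^ j.val)]
  refine Int.ModEq.sum fun j _ => ?_
  have hval : (j + 1).val = (j.val + 1) % f := by
    rw [ZMod.val_add, ZMod.val_one_eq_one_mod, Nat.add_mod_mod]
  have h := (pow_mod_modEq_pow a f (j.val + 1)).symm.mul_left (c (j + 1))
  rw [← hval, pow_succ', ← mul_assoc] at h
  simpa using h

theorem mem_deltaSS (f : ℕ) (Jrho J : Finset (ZMod f)) (j : ZMod f) :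
    j ∈ deltaSS f Jrho J ↔ j + 1 ∈ J ∧ j ∈ Jrho := by
  simp [deltaSS, shiftSet, ← sub_eq_add_neg, sub_eq_iff_eq_add]

/-- The digitwise difference of the two sides is a coboundary for the digit rotation. -/
theorem sfun_deltaSS_digit (p f : ℕ) (r : ZMod f → ℤ) (Jrho J : Finset (ZMod f)) (j : ZMod f) :
    (if j + 1 ∈ J ∆ deltaSS f Jrho J then (p : ℤ) - 1 - sfun p f r Jrho (deltaSS f Jrho J) j else 0)
        - sfun p f r Jrho J j
        - (if j + 1 ∉ J ∆ deltaSS f Jrho J then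
            (p : ℤ) - 1 - sfun p f r Jrho (deltaSS f Jrho J) j else 0)
      = (if j + 1 ∈ J ∆ deltaSS f Jrho J then 0 else -1) * (p : ℤ)
        - (if j ∈ J ∆ deltaSS f Jrho J then 0 else -1) := by
  have hj := mem_deltaSS f Jrho J j
  simp only [Finset.mem_symmDiff, sfun]
  by_cases hx : j ∈ J <;> by_cases hy : j + 1 ∈ J <;> by_cases hρ : j ∈ Jrho <;>
    by_cases hl : j + 1 ∈ deltaSS f Jrho J <;>
    simp only [hy, hρ, and_true, and_false, iff_true, iff_false] at hj <;>
    simp [hx, hy, hρ, hl, hj] <;> ring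

/-- congruence mod `q−1`. -/
theorem statement17 (p f : ℕ) [NeZero f] (hp : p.Prime) (hf : 1 ≤ f)
    (r : ZMod f → ℤ)
    (hr : ∀ j, max 12 (2 * (f : ℤ) + 1) ≤ r j ∧ r j ≤ (p : ℤ) - max 15 (2 * (f : ℤ) + 3))
    (Jrho : Finset (ZMod f)) :
    ∀ J : Finset (ZMod f),
      Int.ModEq ((p : ℤ) ^ f - 1)
        ((∑ j ∈ Finset.univ.filter (fun j : ZMod f => j + 1 ∈ J ∆ deltaSS f Jrho J),
            ((p : ℤ) - 1 - sfun p f r Jrho (deltaSS f Jrho J) j) * (p : ℤ) ^ j.val)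
          - ∑ j : ZMod f, sfun p f r Jrho J j * (p : ℤ) ^ j.val)
        (∑ j ∈ Finset.univ.filter (fun j : ZMod f => j + 1 ∉ J ∆ deltaSS f Jrho J),
            ((p : ℤ) - 1 - sfun p f r Jrho (deltaSS f Jrho J) j) * (p : ℤ) ^ j.val) := by
  intro J
  rw [Int.modEq_comm, Int.modEq_iff_dvd]
  let c : ZMod f → ℤ := fun j => if j ∈ J ∆ deltaSS f Jrho J then 0 else -1
  convert (sum_shift_modEq (p : ℤ) f c).symm.dvd using 1
  rw [Finset.sum_filter, Finset.sum_filter, ← Finset.sum_sub_distrib, ← Finset.sum_sub_distrib,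
    ← Finset.sum_sub_distrib]
  refine Finset.sum_congr rfl fun j _ => ?_
  rw [← sub_mul, ← sfun_deltaSS_digit p f r Jrho J j]
  simp only [sub_mul, ite_mul, zero_mul]
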